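/- arXiv:1511.02768 — 3 statements merged into one kernel-verified Lean document; each statement's English description precedes it below -/
import Mathlib

section
/- Let G be a finite acyclic simple graph (a forest) in which every vertex has degree at least 1 (no isolated vertices). Then any graph automorphism of G that fixes every vertex of degree 1 is the identity. -/
namespace SimpleGraph

variable {V : Type*} {G : SimpleGraph V}

/-- In a finite graph, every vertex lies on a path that is longest among the paths through it. -/
theorem exists_longest_isPath_through [Fintype V] (v : V) :
    ∃ (a b : V) (p : G.Walk a b), p.IsPath ∧ v ∈ p.support ∧
      ∀ (c d : V) (q : G.Walk c d), q.IsPath → v ∈ q.support → q.length ≤ p.length := by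
  let S : Set ℕ :=
    {n | ∃ (a b : V) (p : G.Walk a b), p.IsPath ∧ v ∈ p.support ∧ p.length = n}
  have hne : S.Nonempty := ⟨0, v, v, .nil, .nil, by simp, rfl⟩
  have hbdd : BddAbove S := by
    refine ⟨Fintype.card V, ?_⟩
    rintro _ ⟨a, b, p, hp, -, rfl⟩
    exact hp.length_lt.le
  obtain ⟨a, b, p, hp, hv, hlen⟩ := Nat.sSup_mem hne hbdd
  refine ⟨a, b, p, hp, hv, fun c d q hq hvq => ?_⟩
  rw [hlen]
  exact le_csSup hbdd ⟨c, d, q, hq, hvq, rfl⟩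

/-- In an acyclic graph, a path whose start has degree at least two can be extended backwards. -/
theorem IsAcyclic.exists_adj_isPath_cons (hG : G.IsAcyclic) {a b : V} [Fintype (G.neighborSet a)]
    {p : G.Walk a b} (hp : p.IsPath) (ha : 1 < G.degree a) :
    ∃ (c : V) (h : G.Adj c a), (Walk.cons h p).IsPath := by
  obtain ⟨c, hc, hne⟩ := Finset.exists_mem_ne ha p.snd
  rw [mem_neighborFinset] at hc
  exact ⟨c, hc.symm, hp.cons fun hmem => hne (hG.eq_snd_of_adj_start hp hc hmem)⟩

/-- A longest path through `v` in a forest without isolated vertices starts at a leaf. -/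
theorem IsAcyclic.degree_start_eq_one_of_longest (hG : G.IsAcyclic) {v a b : V}
    [Fintype (G.neighborSet a)] (ha : 1 ≤ G.degree a) {p : G.Walk a b} (hp : p.IsPath)
    (hv : v ∈ p.support)
    (hmax : ∀ (c d : V) (q : G.Walk c d), q.IsPath → v ∈ q.support → q.length ≤ p.length) :
    G.degree a = 1 := by
  by_contra hne
  obtain ⟨c, h, hq⟩ := hG.exists_adj_isPath_cons hp (by omega)
  have := hmax _ _ _ hq (by simp [hv])
  simp at this

/-- An automorphism of a forest fixing both ends of a path fixes the path pointwise. -/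
theorem IsAcyclic.iso_apply_eq_of_mem_support (hG : G.IsAcyclic) (φ : G ≃g G) {a b v : V}
    {p : G.Walk a b} (hp : p.IsPath) (ha : φ a = a) (hb : φ b = b) (hv : v ∈ p.support) :
    φ v = v := by
  have hq : ((p.map φ.toHom).copy ha hb).IsPath := by
    simpa using hp.map φ.injective
  have heq : (p.map φ.toHom).copy ha hb = p :=
    congrArg Subtype.val ((hG.subsingleton_path a b).elim ⟨_, hq⟩ ⟨p, hp⟩)
  have hsupp : p.support.map φ = p.support.map id := by
    simpa using congrArg Walk.support heq
  exact List.map_inj_left.mp hsupp v hv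

end SimpleGraph

/-- Any automorphism of a finite forest without isolated vertices (every vertex has degree at
least 1) that fixes every leaf (degree-1 vertex) is the identity. -/
theorem forest_aut_fixing_leaves_eq_id {V : Type} [Fintype V]
    (G : SimpleGraph V) [DecidableRel G.Adj] (hforest : G.IsAcyclic)
    (hdeg : ∀ v : V, 1 ≤ G.degree v)
    (φ : G ≃g G) (hfix : ∀ v : V, G.degree v = 1 → φ v = v) :
    ∀ v : V, φ v = v := by
  intro v
  obtain ⟨a, b, p, hp, hv, hmax⟩ := G.exists_longest_isPath_through v
  have ha := hforest.degree_start_eq_one_of_longest (hdeg a) hp hv hmax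
  have hb := hforest.degree_start_eq_one_of_longest (hdeg b) hp.reverse (v := v) (by simpa using hv)
    (by simpa using hmax)
  exact hforest.iso_apply_eq_of_mem_support φ hp (hfix a ha) (hfix b hb) hv
end

section
/- Let ℓ ≥ 1, let V : Fin ℓ → (finite-dimensional real vector space), and for each j let W j ⊆ V j be a subspace. Inside the tensor product ⨂_{j} V j (PiTensorProduct over Fin ℓ), for each index j let S_j denote the image of the map induced by the family of linear maps that is the inclusion W j ↪ V j in slot j and the identity in every other slot. Then the intersection ⨅_j S_j equals the image of the map ⨂_j W j → ⨂_j V j induced by all the inclusions W j ↪ V j. -/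
open scoped TensorProduct

namespace PiTensorProduct

variable {ι K : Type*} {V : ι → Type*}

/-- The image of a tensor product of submodules is monotone in the submodules. -/
theorem range_map_subtype_mono [CommSemiring K] [∀ i, AddCommMonoid (V i)] [∀ i, Module K (V i)]
    {W W' : ∀ i, Submodule K (V i)} (h : W ≤ W') :
    LinearMap.range (map fun i => (W i).subtype) ≤
      LinearMap.range (map fun i => (W' i).subtype) := by
  have hcomp : (fun i => (W i).subtype) =
      fun i => (W' i).subtype ∘ₗ Submodule.inclusion (h i) := rfl
  rw [hcomp, map_comp]
  exact LinearMap.range_comp_le_range _ _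

/-- If `q i` fixes `W i` pointwise for every `i`, then the tensor product of the `q i` fixes the
image of the tensor product of the `W i` pointwise. -/
theorem map_apply_of_mem_range_map_subtype [CommSemiring K] [∀ i, AddCommMonoid (V i)]
    [∀ i, Module K (V i)] {W : ∀ i, Submodule K (V i)} {q : ∀ i, V i →ₗ[K] V i}
    (hq : ∀ i, ∀ w ∈ W i, q i w = w) {x : ⨂[K] i, V i}
    (hx : x ∈ LinearMap.range (map fun i => (W i).subtype)) : map q x = x := by
  obtain ⟨y, rfl⟩ := hx
  have hcomp : (fun i => q i ∘ₗ (W i).subtype) = fun i => (W i).subtype := by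
    ext i w
    exact hq i w w.2
  rw [← LinearMap.comp_apply, ← map_comp, hcomp]

/-- A tensor fixed by each `q i` acting in slot `i` alone is fixed by all of them acting
simultaneously on any finite set of slots. -/
theorem map_ite_mem_apply_of_forall [DecidableEq ι] [CommSemiring K] [∀ i, AddCommMonoid (V i)]
    [∀ i, Module K (V i)] {q : ∀ i, V i →ₗ[K] V i} {x : ⨂[K] i, V i}
    (hx : ∀ j, map (fun i => if i = j then q i else LinearMap.id) x = x) (s : Finset ι) :
    map (fun i => if i ∈ s then q i else LinearMap.id) x = x := by
  induction s using Finset.induction_on with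
  | empty => simp
  | insert j s hj ih =>
    have hcomp : (fun i => if i ∈ insert j s then q i else LinearMap.id) =
        fun i => (if i = j then q i else LinearMap.id) ∘ₗ
          (if i ∈ s then q i else LinearMap.id) := by
      funext i
      by_cases hi : i = j
      · subst hi
        simp [hj]
      · simp [hi]
    rw [hcomp, map_comp, LinearMap.comp_apply, ih, hx]

/-- Over a field, the image of a tensor product of subspaces is the intersection of the images
in which a single factor is restricted. -/
theorem iInf_range_map_subtype [Fintype ι] [DecidableEq ι] [Field K] [∀ i, AddCommGroup (V i)]
    [∀ i, Module K (V i)] (W : ∀ i, Submodule K (V i)) :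
    (⨅ j : ι, LinearMap.range (map
        (fun i => (if i = j then W i else (⊤ : Submodule K (V i))).subtype))) =
      LinearMap.range (map fun i => (W i).subtype) := by
  apply le_antisymm
  · intro x hx
    rw [Submodule.mem_iInf] at hx
    choose p hp using fun i => (W i).subtype.exists_leftInverse_of_injective (W i).ker_subtype
    have hfix : map (fun i => (W i).subtype ∘ₗ p i) x = x := by
      refine Eq.trans ?_ (map_ite_mem_apply_of_forall (q := fun i => (W i).subtype ∘ₗ p i)
        (fun j => map_apply_of_mem_range_map_subtype (fun i w hw => ?_) (hx j)) Finset.univ)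
      · simp
      · split_ifs at hw ⊢ with hi
        · exact congrArg Subtype.val (LinearMap.congr_fun (hp i) ⟨w, hw⟩)
        · rfl
    rw [map_comp] at hfix
    exact ⟨_, hfix⟩
  · refine le_iInf fun j => range_map_subtype_mono fun i => ?_
    split_ifs
    · exact le_rfl
    · exact le_top

end PiTensorProduct

/-- Lemma 4.7 (complement form): for finite-dimensional real vector spaces `V j`, `j : Fin ℓ`,
with subspaces `W j ⊆ V j`, inside the tensor product `⨂ j, V j` the intersection over `j` of
the images of the maps induced by the family which is the inclusion `W j ↪ V j` in slot `j`
and the identity (inclusion of the full subspace `⊤`) in every other slot equals the image of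
the map `⨂ j, W j → ⨂ j, V j` induced by all the inclusions. -/
theorem iInf_range_piTensor_eq_range_piTensor (ℓ : ℕ) (hℓ : 1 ≤ ℓ)
    (V : Fin ℓ → Type) [∀ j, AddCommGroup (V j)] [∀ j, Module ℝ (V j)]
    [∀ j, FiniteDimensional ℝ (V j)] (W : ∀ j, Submodule ℝ (V j)) :
    (⨅ j : Fin ℓ, LinearMap.range (PiTensorProduct.map
        (fun i : Fin ℓ => (if i = j then W i else (⊤ : Submodule ℝ (V i))).subtype))) =
      LinearMap.range (PiTensorProduct.map fun i : Fin ℓ => (W i).subtype) := by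
  exact PiTensorProduct.iInf_range_map_subtype W
end

section
/- Let R be a field (e.g. ℝ), let σ and τ be types, and let m be a natural number. In the multivariate polynomial ring R[X_i : i ∈ σ ⊕ τ], let H be the submodule of homogeneous polynomials of degree m, let A be the intersection of H with the ideal generated by the variables {X (inl s) : s ∈ σ}, and let B be the intersection of H with the subalgebra of polynomials supported only on the variables {X (inr t) : t ∈ τ}. Then H is the internal direct sum of A and B: H = A ⊔ B and A ⊓ B = ⊥. -/
namespace MvPolynomial

variable {ι R : Type*} [CommSemiring R]

theorem mem_supported_compl_iff {s : Set ι} {p : MvPolynomial ι R} :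
    p ∈ supported R sᶜ ↔ ∀ d ∈ p.support, ∀ i ∈ s, d i = 0 := by
  simp only [mem_supported, Set.subset_def, Finset.mem_coe, mem_vars_iff_mem_support,
    Finsupp.mem_support_iff, Set.mem_compl_iff]
  grind

theorem disjoint_span_X_image_supported_compl (s : Set ι) :
    Disjoint ((Ideal.span (X '' s : Set (MvPolynomial ι R))).restrictScalars R)
      (Subalgebra.toSubmodule (supported R sᶜ)) := by
  rw [Submodule.disjoint_def]
  intro p hA hB
  rw [Submodule.restrictScalars_mem, mem_ideal_span_X_image] at hA
  rw [Subalgebra.mem_toSubmodule, mem_supported_compl_iff] at hB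
  rw [← support_eq_empty, Finset.eq_empty_iff_forall_notMem]
  intro d hd
  obtain ⟨i, hi, hdi⟩ := hA d hd
  exact hdi (hB d hd i hi)

theorem monomial_mem_span_X_image_or_mem_supported_compl (s : Set ι) (d : ι →₀ ℕ) (r : R) :
    monomial d r ∈ Ideal.span (X '' s : Set (MvPolynomial ι R)) ∨
      monomial d r ∈ supported R sᶜ := by
  rw [mem_ideal_span_X_image, mem_supported_compl_iff]
  have h (e : ι →₀ ℕ) (he : e ∈ (monomial d r).support) : e = d :=
    Finset.mem_singleton.mp (support_monomial_subset he)
  by_cases hd : ∃ i ∈ s, d i ≠ 0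
  · exact .inl fun e he => h e he ▸ hd
  · push Not at hd
    exact .inr fun e he => h e he ▸ hd

theorem homogeneousSubmodule_eq_span_X_image_sup_supported_compl (s : Set ι) (m : ℕ) :
    homogeneousSubmodule ι R m =
      (homogeneousSubmodule ι R m ⊓
        (Ideal.span (X '' s : Set (MvPolynomial ι R))).restrictScalars R) ⊔
      (homogeneousSubmodule ι R m ⊓ Subalgebra.toSubmodule (supported R sᶜ)) := by
  refine le_antisymm (fun p hp => ?_) (sup_le inf_le_left inf_le_left)
  rw [p.as_sum]
  refine Submodule.sum_mem _ fun d hd => ?_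
  have hom : monomial d (coeff d p) ∈ homogeneousSubmodule ι R m :=
    isHomogeneous_monomial _ <| by
      rw [Finsupp.degree_eq_weight_one]
      exact hp (mem_support_iff.mp hd)
  rcases monomial_mem_span_X_image_or_mem_supported_compl s d (coeff d p) with h | h
  · exact Submodule.mem_sup_left ⟨hom, h⟩
  · exact Submodule.mem_sup_right ⟨hom, h⟩

end MvPolynomial

/-- Lemma 4.8 in coordinates: in the polynomial ring `R[X i : i : σ ⊕ τ]` over a field `R`,
the submodule `H` of homogeneous polynomials of degree `m` is the internal direct sum of
`A = H ⊓ (ideal generated by the σ-variables)` and `B = H ⊓ (polynomials supported on the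
τ-variables)`. -/
theorem homogeneous_eq_ideal_sup_supported (R : Type) [Field R] (σ τ : Type) (m : ℕ) :
    (MvPolynomial.homogeneousSubmodule (σ ⊕ τ) R m =
        (MvPolynomial.homogeneousSubmodule (σ ⊕ τ) R m ⊓
          Submodule.restrictScalars R (Ideal.span
            (Set.range fun s : σ => (MvPolynomial.X (Sum.inl s) : MvPolynomial (σ ⊕ τ) R)))) ⊔
        (MvPolynomial.homogeneousSubmodule (σ ⊕ τ) R m ⊓
          (MvPolynomial.supported R (Set.range (Sum.inr : τ → σ ⊕ τ))).toSubmodule)) ∧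
      ((MvPolynomial.homogeneousSubmodule (σ ⊕ τ) R m ⊓
          Submodule.restrictScalars R (Ideal.span
            (Set.range fun s : σ => (MvPolynomial.X (Sum.inl s) : MvPolynomial (σ ⊕ τ) R)))) ⊓
        (MvPolynomial.homogeneousSubmodule (σ ⊕ τ) R m ⊓
          (MvPolynomial.supported R (Set.range (Sum.inr : τ → σ ⊕ τ))).toSubmodule) = ⊥) := by
  rw [Set.range_comp' MvPolynomial.X Sum.inl, ← Set.compl_range_inl]
  refine ⟨MvPolynomial.homogeneousSubmodule_eq_span_X_image_sup_supported_compl _ m, ?_⟩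
  exact ((MvPolynomial.disjoint_span_X_image_supported_compl _).mono
    inf_le_right inf_le_right).eq_bot
end
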